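/- Let ℓ be a prime with ℓ ≡ 1 (mod 30) or ℓ ≡ 19 (mod 30). Then the number of integer solutions (x,y,z) to x² + y² + 3z² = 5ℓ² equals 16ℓ. -/

import Mathlib

/-- The order `ℤ⟨1, i, j, k⟩` with `i² = -1`, `j² = -3` in the quaternion algebra of
discriminant `3`. -/
abbrev Quat : Type := QuaternionAlgebra ℤ (-1) 0 (-3)

namespace Quat

/-- The reduced norm on `Quat`. -/
def nrm (q : Quat) : ℤ := q.re ^ 2 + q.imI ^ 2 + 3 * q.imJ ^ 2 + 3 * q.imK ^ 2

theorem nrm_mul (p q : Quat) : nrm (p * q) = nrm p * nrm q := by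
  simp [nrm]; ring

theorem nrm_star (q : Quat) : nrm (star q) = nrm q := by
  simp [nrm]

theorem nrm_smul (n : ℤ) (q : Quat) : nrm (n • q) = n ^ 2 * nrm q := by
  simp [nrm]; ring

theorem nrm_nonneg (q : Quat) : 0 ≤ nrm q := by
  unfold nrm; positivity

theorem nrm_pos {q : Quat} (hq : q ≠ 0) : 0 < nrm q := by
  refine (nrm_nonneg q).lt_of_ne fun h => hq ?_
  unfold nrm at h
  ext <;> simp only [QuaternionAlgebra.re_zero, QuaternionAlgebra.imI_zero,
    QuaternionAlgebra.imJ_zero, QuaternionAlgebra.imK_zero] <;> nlinarith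

theorem star_mul_self_mul (p q : Quat) : star p * (p * q) = nrm p • q := by
  ext <;> simp [nrm, -zsmul_eq_mul] <;> ring

theorem mul_star_self_mul (p q : Quat) : p * (star p * q) = nrm p • q := by
  ext <;> simp [nrm, -zsmul_eq_mul] <;> ring

theorem mul_mul_star_self (p q : Quat) : (q * p) * star p = nrm p • q := by
  ext <;> simp [nrm, -zsmul_eq_mul] <;> ring

theorem mul_star_mul_self (p q : Quat) : (q * star p) * p = nrm p • q := by
  ext <;> simp [nrm, -zsmul_eq_mul] <;> ring

theorem smul_cancel {n : ℤ} (hn : n ≠ 0) {p q : Quat} (h : n • p = n • q) : p = q := by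
  exact smul_right_injective Quat hn h

theorem exists_two_mul_abs_sub_le (x : ℤ) {n : ℤ} (hn : 0 < n) : ∃ u : ℤ, 2 * |x - n * u| ≤ n := by
  refine ⟨(2 * x + n) / (2 * n), ?_⟩
  have h1 := Int.emod_add_mul_ediv (2 * x + n) (2 * n)
  have h2 := Int.emod_nonneg (2 * x + n) (show 2 * n ≠ 0 by lia)
  have h3 := Int.emod_lt_of_pos (2 * x + n) (show 0 < 2 * n by lia)
  set u := (2 * x + n) / (2 * n)
  have h4 : |x - n * u| = x - n * u ∨ |x - n * u| = -(x - n * u) := abs_choice _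
  rcases h4 with h4 | h4 <;> rw [h4] <;> linarith

/-- The elements of `2 • O`, where `O` is the maximal order spanned by `Quat` together with
`(1 + j) / 2` and `(i + k) / 2`. -/
def IsTwiceIntegral (q : Quat) : Prop := 2 ∣ q.re - q.imJ ∧ 2 ∣ q.imI - q.imK

theorem IsTwiceIntegral.sub {p q : Quat} (hp : p.IsTwiceIntegral) (hq : q.IsTwiceIntegral) :
    (p - q).IsTwiceIntegral := by
  unfold IsTwiceIntegral at *
  simp only [QuaternionAlgebra.re_sub, QuaternionAlgebra.imI_sub, QuaternionAlgebra.imJ_sub,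
    QuaternionAlgebra.imK_sub]
  lia

theorem isTwiceIntegral_two_smul (q : Quat) : ((2 : ℤ) • q).IsTwiceIntegral := by
  simp only [IsTwiceIntegral, QuaternionAlgebra.re_smul, QuaternionAlgebra.imI_smul,
    QuaternionAlgebra.imJ_smul, QuaternionAlgebra.imK_smul, smul_eq_mul]
  lia

theorem IsTwiceIntegral.exists_eq {q : Quat} (hq : q.IsTwiceIntegral) :
    ∃ c d u v : ℤ, q = ⟨c + 2 * u, d + 2 * v, c, d⟩ := by
  obtain ⟨⟨u, hu⟩, v, hv⟩ := hq
  exact ⟨q.imJ, q.imK, u, v, by ext <;> simp <;> lia⟩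

theorem IsTwiceIntegral.exists_mul_eq {p q : Quat} (hp : p.IsTwiceIntegral)
    (hq : q.IsTwiceIntegral) : ∃ r : Quat, p * q = (2 : ℤ) • r ∧ r.IsTwiceIntegral := by
  obtain ⟨c, d, u, v, rfl⟩ := hp.exists_eq
  obtain ⟨c', d', u', v', rfl⟩ := hq.exists_eq
  refine ⟨⟨-c * c' + u * c' + c * u' + 2 * u * u' - 2 * d * d' - v * d' - d * v' - 2 * v * v',
    2 * c * d' - d * c' + c * v' + u * d' + 2 * u * v' + d * u' + v * c' + 2 * v * u',
    c * c' + u * c' + c * u' - v * d' + d * v',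
    u * d' + d * u' + d * c' + v * c' - c * v'⟩, ?_,
    ⟨-c * c' + u * u' - d * d' - d * v' - v * v', by ring⟩,
    ⟨c * d' - d * c' + c * v' + u * v' + v * u', by ring⟩⟩
  ext <;> simp [-zsmul_eq_mul] <;> ring

theorem IsTwiceIntegral.four_dvd_nrm {q : Quat} (hq : q.IsTwiceIntegral) : 4 ∣ nrm q := by
  obtain ⟨c, d, u, v, rfl⟩ := hq.exists_eq
  exact ⟨c ^ 2 + c * u + u ^ 2 + d ^ 2 + d * v + v ^ 2, by simp only [nrm]; ring⟩

/-- Rounding to the maximal order. -/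
theorem exists_nrm_sub_lt (g : Quat) {n : ℤ} (hn : 0 < n) :
    ∃ δ : Quat, δ.IsTwiceIntegral ∧ nrm ((2 : ℤ) • g - n • δ) < 4 * n ^ 2 := by
  have key (A C : ℤ) : ∃ c u : ℤ,
      4 * ((2 * A - n * (c + 2 * u)) ^ 2 + 3 * (2 * C - n * c) ^ 2) ≤ 7 * n ^ 2 := by
    obtain ⟨c, hc⟩ := exists_two_mul_abs_sub_le (2 * C) hn
    obtain ⟨u, hu⟩ := exists_two_mul_abs_sub_le (2 * A - n * c) (show 0 < 2 * n by lia)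
    refine ⟨c, u, ?_⟩
    rw [← sq_abs (2 * A - n * (c + 2 * u)), ← sq_abs (2 * C - n * c)]
    rw [show 2 * A - n * c - 2 * n * u = 2 * A - n * (c + 2 * u) by ring] at hu
    nlinarith [abs_nonneg (2 * A - n * (c + 2 * u)), abs_nonneg (2 * C - n * c)]
  obtain ⟨c, u, h1⟩ := key g.re g.imJ
  obtain ⟨d, v, h2⟩ := key g.imI g.imK
  refine ⟨⟨c + 2 * u, d + 2 * v, c, d⟩, ⟨⟨u, by simp⟩, ⟨v, by simp⟩⟩, ?_⟩
  simp only [nrm, QuaternionAlgebra.re_sub, QuaternionAlgebra.imI_sub, QuaternionAlgebra.imJ_sub,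
    QuaternionAlgebra.imK_sub, QuaternionAlgebra.re_smul, QuaternionAlgebra.imI_smul,
    QuaternionAlgebra.imJ_smul, QuaternionAlgebra.imK_smul, smul_eq_mul]
  nlinarith

/-- An element of odd norm in the maximal order has an associate in `Quat`. -/
theorem IsTwiceIntegral.exists_mul_eq_four_smul {β : Quat} (hβ : β.IsTwiceIntegral) {m : ℤ}
    (hm : Odd m) (h : nrm β = 4 * m) : ∃ u γ : Quat, nrm u = 4 ∧ β * u = (4 : ℤ) • γ := by
  obtain ⟨c, d, u, v, rfl⟩ := hβ.exists_eq
  have hodd : c ^ 2 + c * u + u ^ 2 + d ^ 2 + d * v + v ^ 2 = m := by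
    simp only [nrm] at h
    linarith
  have hcases : (Even c ∧ Even d) ∨ (Even u ∧ Even v) ∨ (Even (c + u) ∧ Even (d + v)) := by
    rw [← hodd, ← Int.not_even_iff_odd] at hm
    simp only [Int.even_add, Int.even_mul, Int.even_pow, ne_eq, OfNat.ofNat_ne_zero,
      not_false_eq_true, and_true] at hm ⊢
    tauto
  rcases hcases with ⟨⟨x, hx⟩, y, hy⟩ | ⟨⟨x, hx⟩, y, hy⟩ | ⟨⟨x, hx⟩, y, hy⟩
  · refine ⟨⟨2, 0, 0, 0⟩, ⟨x + u, y + v, x, y⟩, by simp [nrm], ?_⟩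
    subst hx hy
    ext <;> simp [-zsmul_eq_mul] <;> ring
  · refine ⟨⟨1, 0, -1, 0⟩, ⟨c + x, d + y, -x, -y⟩, by simp [nrm], ?_⟩
    subst hx hy
    ext <;> simp [-zsmul_eq_mul] <;> ring
  · refine ⟨⟨1, 0, 1, 0⟩, ⟨x - c, y - d, x, y⟩, by simp [nrm], ?_⟩
    obtain rfl : u = x + x - c := by lia
    obtain rfl : v = y + y - d := by lia
    ext <;> simp [-zsmul_eq_mul] <;> ring

/-- Division with remainder by an element of minimal norm. -/
theorem exists_two_smul_eq_mul {P : Quat → Prop} {β : Quat} (hβ : P β) (hβ0 : β ≠ 0)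
    (hmin : ∀ q, P q → q ≠ 0 → nrm β ≤ nrm q) (hint : ∀ q, P q → q.IsTwiceIntegral)
    (hsub : ∀ p q, P p → P q → P (p - q))
    (hmul : ∀ p q r, P p → r.IsTwiceIntegral → p * q = (2 : ℤ) • r → P r)
    {α : Quat} (hα : P α) : ∃ δ : Quat, δ.IsTwiceIntegral ∧ (2 : ℤ) • α = β * δ := by
  have hn := nrm_pos hβ0
  obtain ⟨δ, hδ, hlt⟩ := exists_nrm_sub_lt (star β * α) hn
  obtain ⟨r, hr, hr'⟩ := (hint _ hβ).exists_mul_eq hδ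
  refine ⟨δ, hδ, ?_⟩
  have hρ : P (α - r) := hsub _ _ hα (hmul _ _ _ hβ hr' hr)
  by_contra hne
  have hρ0 : α - r ≠ 0 := fun h0 => hne (by rw [hr, sub_eq_zero.1 h0])
  have hle := hmin _ hρ hρ0
  have hnorm : nrm ((2 : ℤ) • (star β * α) - nrm β • δ) = nrm β * (4 * nrm (α - r)) := by
    rw [← star_mul_self_mul, hr, mul_smul_comm, ← smul_sub, ← mul_sub, nrm_smul, nrm_mul, nrm_star]
    ring
  rw [hnorm] at hlt
  nlinarith

section Reduction

variable {F : Type*} [Field F]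

/-- The representation of `Quat` by `2 × 2` matrices over a field containing a square root `s`
of `-3`. -/
def toMatrix (s : F) (hs : s ^ 2 = -3) : Quat →+* Matrix (Fin 2) (Fin 2) F where
  toFun q := !![q.re + s * q.imJ, q.imI - s * q.imK; -q.imI - s * q.imK, q.re - s * q.imJ]
  map_one' := by ext i j; fin_cases i <;> fin_cases j <;> simp
  map_zero' := by ext i j; fin_cases i <;> fin_cases j <;> simp
  map_add' p q := by ext i j; fin_cases i <;> fin_cases j <;> simp <;> ring
  map_mul' p q := by
    ext i j
    fin_cases i <;> fin_cases j <;> simp [Matrix.mul_apply, Fin.sum_univ_two]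
    · linear_combination -(p.imJ * q.imJ + p.imK * q.imK : F) * hs
    · linear_combination (p.imJ * q.imK - p.imK * q.imJ : F) * hs
    · linear_combination (p.imK * q.imJ - p.imJ * q.imK : F) * hs
    · linear_combination -(p.imJ * q.imJ + p.imK * q.imK : F) * hs

variable {s : F} (hs : s ^ 2 = -3)

theorem toMatrix_apply (q : Quat) : toMatrix s hs q =
    !![q.re + s * q.imJ, q.imI - s * q.imK; -q.imI - s * q.imK, q.re - s * q.imJ] := rfl

theorem toMatrix_zsmul (n : ℤ) (q : Quat) : toMatrix s hs (n • q) = (n : F) • toMatrix s hs q := by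
  rw [map_zsmul]
  ext i j
  simp

theorem det_toMatrix (q : Quat) : (toMatrix s hs q).det = (nrm q : F) := by
  simp only [toMatrix_apply, Matrix.det_fin_two_of, nrm]
  push_cast
  linear_combination (-(q.imJ : F) ^ 2 - q.imK ^ 2) * hs

theorem toMatrix_star (q : Quat) : toMatrix s hs (star q) = (toMatrix s hs q).adjugate := by
  simp only [toMatrix_apply, Matrix.adjugate_fin_two_of]
  ext i j
  fin_cases i <;> fin_cases j <;> simp <;> ring

theorem exists_eq_vecMulVec {l : Fin 2 → F} (hl : l ≠ 0) {X : Matrix (Fin 2) (Fin 2) F}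
    (hX : Matrix.vecMul l X = 0) : ∃ y, X = Matrix.vecMulVec ![l 1, -l 0] y := by
  have h (j : Fin 2) : l 0 * X 0 j + l 1 * X 1 j = 0 := by
    simpa [Matrix.vecMul, dotProduct, Fin.sum_univ_two] using congrFun hX j
  by_cases h1 : l 1 = 0
  · have h0 : l 0 ≠ 0 := fun h0 => hl <| by ext i; fin_cases i <;> simp [h0, h1]
    refine ⟨fun j => -X 1 j / l 0, ?_⟩
    ext i j
    have := h j
    fin_cases i <;> simp_all [Matrix.vecMulVec_apply]
    field_simp
  · refine ⟨fun j => X 0 j / l 1, ?_⟩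
    ext i j
    have := h j
    fin_cases i <;> simp [Matrix.vecMulVec_apply]
    · field_simp
    · field_simp
      linear_combination this

theorem adjugate_mul_eq_zero {l : Fin 2 → F} (hl : l ≠ 0) {X Y : Matrix (Fin 2) (Fin 2) F}
    (hX : Matrix.vecMul l X = 0) (hY : Matrix.vecMul l Y = 0) : X.adjugate * Y = 0 := by
  obtain ⟨x, rfl⟩ := exists_eq_vecMulVec hl hX
  obtain ⟨y, rfl⟩ := exists_eq_vecMulVec hl hY
  ext i j
  fin_cases i <;> fin_cases j <;>
    simp [-Matrix.cons_vecMulVec, Matrix.adjugate_fin_two, Matrix.mul_apply, Fin.sum_univ_two,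
      Matrix.vecMulVec_apply] <;>
    ring

theorem exists_eq_vecMulVec_of_det_eq_zero {X : Matrix (Fin 2) (Fin 2) F} (hX : X.det = 0) :
    ∃ x y, X = Matrix.vecMulVec x y := by
  obtain ⟨l, hl, h⟩ := Matrix.exists_vecMul_eq_zero_iff.2 hX
  exact ⟨_, exists_eq_vecMulVec hl h⟩

theorem mul_eq_zero_of_mul_mul_eq_zero {X G : Matrix (Fin 2) (Fin 2) F} (hX : X.det = 0)
    (hG : G.det = 0) (hXG : X * G ≠ 0) (h : X * G * X = 0) : G * X = 0 := by
  obtain ⟨x, y, rfl⟩ := exists_eq_vecMulVec_of_det_eq_zero hX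
  obtain ⟨u, z, rfl⟩ := exists_eq_vecMulVec_of_det_eq_zero hG
  simp only [Matrix.vecMulVec_mul_vecMulVec, Matrix.vecMulVec_smul,
    smul_mul_assoc] at *
  aesop

theorem adjugate_mul_mul_eq_zero_iff {l : Fin 2 → F} (hl : l ≠ 0)
    {X M : Matrix (Fin 2) (Fin 2) F} (hX : Matrix.vecMul l X = 0) (hX0 : X ≠ 0) :
    X.adjugate * M * X = 0 ↔ dotProduct (Matrix.vecMul l M) ![l 1, -l 0] = 0 := by
  obtain ⟨y, rfl⟩ := exists_eq_vecMulVec hl hX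
  have hy : y ≠ 0 := by rintro rfl; simp at hX0
  have key : (Matrix.vecMulVec ![l 1, -l 0] y).adjugate * M * Matrix.vecMulVec ![l 1, -l 0] y =
      dotProduct (Matrix.vecMul l M) ![l 1, -l 0] • Matrix.vecMulVec ![-y 1, y 0] y := by
    ext i j
    fin_cases i <;> fin_cases j <;>
      simp [-Matrix.cons_vecMulVec, Matrix.adjugate_fin_two, Matrix.mul_apply, Fin.sum_univ_two,
        Matrix.vecMulVec_apply, Matrix.vecMul, dotProduct] <;> ring
  rw [key, smul_eq_zero, or_iff_left]
  intro h
  have h' (i j) : ![-y 1, y 0] i * y j = 0 := congrFun (congrFun h i) j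
  have h0 := h' 1 0
  have h1 := h' 0 1
  apply hy
  ext i
  fin_cases i <;> simp_all

end Reduction

theorem exists_eq_smul_of_toMatrix_eq_zero {ℓ : ℕ} [Fact ℓ.Prime] {s : ZMod ℓ} (hs : s ^ 2 = -3)
    (h2 : (2 : ZMod ℓ) ≠ 0) (h3 : s ≠ 0) {q : Quat} (hq : toMatrix s hs q = 0) :
    ∃ r : Quat, q = (ℓ : ℤ) • r := by
  have h00 : (q.re + s * q.imJ : ZMod ℓ) = 0 := congrFun (congrFun hq 0) 0
  have h01 : (q.imI - s * q.imK : ZMod ℓ) = 0 := congrFun (congrFun hq 0) 1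
  have h10 : (-q.imI - s * q.imK : ZMod ℓ) = 0 := congrFun (congrFun hq 1) 0
  have h11 : (q.re - s * q.imJ : ZMod ℓ) = 0 := congrFun (congrFun hq 1) 1
  have half {x : ZMod ℓ} (h : 2 * x = 0) : x = 0 := (mul_eq_zero.1 h).resolve_left h2
  have hre : (q.re : ZMod ℓ) = 0 := half (by linear_combination h00 + h11)
  have hI : (q.imI : ZMod ℓ) = 0 := half (by linear_combination h01 - h10)
  have hJ : (q.imJ : ZMod ℓ) = 0 :=
    (mul_eq_zero.1 (half (x := s * q.imJ) (by linear_combination h00 - h11))).resolve_left h3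
  have hK : (q.imK : ZMod ℓ) = 0 :=
    (mul_eq_zero.1 (half (x := s * q.imK) (by linear_combination -h01 - h10))).resolve_left h3
  rw [ZMod.intCast_zmod_eq_zero_iff_dvd] at hre hI hJ hK
  obtain ⟨a, ha⟩ := hre
  obtain ⟨b, hb⟩ := hI
  obtain ⟨c, hc⟩ := hJ
  obtain ⟨d, hd⟩ := hK
  exact ⟨⟨a, b, c, d⟩, by ext <;> simp [-zsmul_eq_mul, *]⟩

theorem eq_conj_iff {β : Quat} (hβ : nrm β ≠ 0) (v : Quat) :
    (∃ w, v = β * w * star β) ↔ ∃ w, star β * v * β = nrm β ^ 2 • w := by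
  refine exists_congr fun w => ⟨?_, fun h => ?_⟩
  · rintro rfl
    rw [mul_assoc β, star_mul_self_mul, smul_mul_assoc, mul_star_mul_self, smul_smul, sq]
  · have h' : β * (star β * v * β) * star β = nrm β ^ 2 • v := by
      rw [mul_assoc (star β), mul_star_self_mul, smul_mul_assoc, mul_mul_star_self, smul_smul, sq]
    rw [h, mul_smul_comm, smul_mul_assoc] at h'
    exact (smul_cancel (pow_ne_zero 2 hβ) h').symm

section Prime

variable {ℓ : ℕ} [Fact ℓ.Prime] {s : ZMod ℓ} (hs : s ^ 2 = -3)

theorem toMatrix_natCast_smul (q : Quat) : toMatrix s hs ((ℓ : ℤ) • q) = 0 := by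
  simp [-zsmul_eq_mul]

theorem toMatrix_eq_zero_iff (h2 : (2 : ZMod ℓ) ≠ 0) (h3 : s ≠ 0) (q : Quat) :
    toMatrix s hs q = 0 ↔ ∃ r : Quat, q = (ℓ : ℤ) • r :=
  ⟨exists_eq_smul_of_toMatrix_eq_zero hs h2 h3, fun ⟨r, hr⟩ => hr ▸ toMatrix_natCast_smul hs r⟩

/-- The one-sided ideals of norm `ℓ` are principal. -/
theorem exists_nrm_eq (h2 : (2 : ZMod ℓ) ≠ 0) (h3 : s ≠ 0) {l : Fin 2 → ZMod ℓ} (hl : l ≠ 0) :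
    ∃ β : Quat, nrm β = ℓ ∧ Matrix.vecMul l (toMatrix s hs β) = 0 := by
  have hp : ℓ.Prime := Fact.out
  have hℓ0 : (ℓ : ℤ) ≠ 0 := by exact_mod_cast hp.ne_zero
  let P : Quat → Prop := fun q => q.IsTwiceIntegral ∧ Matrix.vecMul l (toMatrix s hs q) = 0
  have h2cancel {v : Fin 2 → ZMod ℓ} (h : (2 : ZMod ℓ) • v = 0) : v = 0 :=
    (smul_eq_zero.1 h).resolve_left h2
  have hsub (p q) (hp : P p) (hq : P q) : P (p - q) :=
    ⟨hp.1.sub hq.1, by rw [map_sub, Matrix.vecMul_sub, hp.2, hq.2, sub_zero]⟩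
  have hmul (p q r) (hp : P p) (hr : r.IsTwiceIntegral) (h : p * q = (2 : ℤ) • r) : P r := by
    refine ⟨hr, h2cancel ?_⟩
    have h' := congrArg (fun x => Matrix.vecMul l (toMatrix s hs x)) h
    simp only [map_mul, toMatrix_zsmul, ← Matrix.vecMul_vecMul, hp.2, Matrix.zero_vecMul,
      Matrix.vecMul_smul] at h'
    exact_mod_cast h'.symm
  obtain ⟨α, hα, hα0⟩ : ∃ α, P α ∧ toMatrix s hs α ≠ 0 := by
    obtain ⟨S, hS⟩ := ZMod.intCast_surjective s
    obtain ⟨x, hx⟩ := ZMod.intCast_surjective (l 0)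
    obtain ⟨y, hy⟩ := ZMod.intCast_surjective (l 1)
    have hM : toMatrix s hs ⟨S * y, S * x, y, x⟩ = (2 * s) • !![l 1, 0; -l 0, 0] := by
      rw [toMatrix_apply]
      ext i j
      fin_cases i <;> fin_cases j <;> simp [hS, hx, hy] <;> ring
    refine ⟨_, ⟨isTwiceIntegral_two_smul ⟨S * y, S * x, y, x⟩, ?_⟩, ?_⟩
    · rw [toMatrix_zsmul, hM]
      ext j
      fin_cases j <;> simp [Matrix.vecMul, dotProduct, Fin.sum_univ_two]
      ring
    · rw [toMatrix_zsmul, hM, smul_smul]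
      refine smul_ne_zero (by simp [h2, h3]) fun h => hl ?_
      have h0 := congrFun (congrFun h 0) 0
      have h1 := congrFun (congrFun h 1) 0
      ext i
      fin_cases i <;> simp_all
  have hαne : α ≠ 0 := by rintro rfl; simp at hα0
  obtain ⟨β, ⟨hβ, hβ0⟩, hmin⟩ := (measure fun q => (nrm q).toNat).wf.has_min
    {q | P q ∧ q ≠ 0} ⟨α, hα, hαne⟩
  have hmin' (q) (hq : P q) (hq0 : q ≠ 0) : nrm β ≤ nrm q := by
    have := hmin q ⟨hq, hq0⟩
    have h1 := nrm_nonneg q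
    have h2 := nrm_nonneg β
    simp only [WellFoundedRelation.rel, InvImage] at this
    lia
  have hdiv {α : Quat} (hα : P α) : ∃ δ : Quat, δ.IsTwiceIntegral ∧ (2 : ℤ) • α = β * δ :=
    exists_two_smul_eq_mul hβ hβ0 hmin' (fun q hq => hq.1) hsub hmul hα
  have hPℓ : P ((2 : ℤ) • (ℓ : ℤ) • (1 : Quat)) := by
    refine ⟨isTwiceIntegral_two_smul _, ?_⟩
    rw [smul_comm, toMatrix_natCast_smul, Matrix.vecMul_zero]
  obtain ⟨δ, hδ, hβδ⟩ := hdiv hPℓ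
  obtain ⟨m, hm⟩ := hβ.1.four_dvd_nrm
  obtain ⟨d, hd⟩ := hδ.four_dvd_nrm
  have hmd : m * d = (ℓ : ℤ) ^ 2 := by
    have h := congrArg nrm hβδ
    rw [nrm_mul, nrm_smul, nrm_smul, nrm_smul, hm, hd] at h
    simp only [nrm, QuaternionAlgebra.re_one, QuaternionAlgebra.imI_one,
      QuaternionAlgebra.imJ_one, QuaternionAlgebra.imK_one] at h
    linarith
  have hmpos : 0 < m := by have := nrm_pos hβ0; lia
  have hℓm : (ℓ : ℤ) ∣ m := by
    have hdet : (toMatrix s hs β).det = 0 := Matrix.exists_vecMul_eq_zero_iff.1 ⟨l, hl, hβ.2⟩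
    rw [det_toMatrix, hm] at hdet
    push_cast at hdet
    rw [← ZMod.intCast_zmod_eq_zero_iff_dvd]
    refine (mul_eq_zero.1 hdet).resolve_left ?_
    rw [show (4 : ZMod ℓ) = 2 * 2 by norm_num]
    exact mul_ne_zero h2 h2
  have hmℓ : m = ℓ := by
    lift m to ℕ using hmpos.le
    obtain ⟨k, hk, rfl⟩ := (Nat.dvd_prime_pow hp).1
      (show m ∣ ℓ ^ 2 by exact_mod_cast Dvd.intro _ hmd)
    interval_cases k
    · have : ℓ ∣ 1 := by exact_mod_cast hℓm
      exact absurd this hp.not_dvd_one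
    · simp
    · exfalso
      have hd1 : d = 1 := by
        push_cast at hmd
        exact mul_left_cancel₀ (pow_ne_zero 2 hℓ0) (by rw [hmd, mul_one])
      have hβℓ : β = (ℓ : ℤ) • star δ := by
        have h := mul_mul_star_self δ β
        rw [← hβδ, hd, hd1] at h
        refine smul_cancel (n := 4) (by norm_num) ?_
        rw [mul_one] at h
        simp only [← h, smul_mul_assoc, one_mul, smul_smul]
        rw [show (2 : ℤ) * (2 * ℓ) = 4 * ℓ by ring]
      obtain ⟨δ', -, h⟩ := hdiv hα
      have h' := congrArg (toMatrix s hs) h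
      rw [hβℓ, smul_mul_assoc, toMatrix_natCast_smul, toMatrix_zsmul] at h'
      exact (smul_ne_zero (by exact_mod_cast h2) hα0) h'
  have hodd : Odd m := by
    rw [hmℓ]
    refine mod_cast hp.odd_of_ne_two ?_
    intro h
    apply h2
    rw [← Nat.cast_ofNat, ← h, ZMod.natCast_self]
  obtain ⟨u, γ, hu, hγ⟩ := hβ.1.exists_mul_eq_four_smul hodd hm
  refine ⟨γ, ?_, ?_⟩
  · have h := congrArg nrm hγ
    rw [nrm_mul, nrm_smul, hu, hm, hmℓ] at h
    linarith
  · have h' := congrArg (fun x => Matrix.vecMul l (toMatrix s hs x)) hγ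
    simp only [map_mul, toMatrix_zsmul, ← Matrix.vecMul_vecMul, hβ.2, Matrix.zero_vecMul,
      Matrix.vecMul_smul] at h'
    refine h2cancel (h2cancel ?_)
    rw [smul_smul, h']
    norm_num

variable {β : Quat} {l : Fin 2 → ZMod ℓ}

theorem toMatrix_ne_zero_of_nrm_eq (h2 : (2 : ZMod ℓ) ≠ 0) (h3 : s ≠ 0) (hβ : nrm β = ℓ) :
    toMatrix s hs β ≠ 0 := by
  intro h
  obtain ⟨r, rfl⟩ := exists_eq_smul_of_toMatrix_eq_zero hs h2 h3 h
  have hp := Nat.prime_iff_prime_int.1 (Fact.out : ℓ.Prime)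
  rw [nrm_smul, sq, mul_assoc] at hβ
  exact hp.not_dvd_one ⟨nrm r, by
    have := mul_left_cancel₀ hp.ne_zero (hβ.trans (mul_one _).symm)
    exact this.symm⟩

theorem eq_conj_iff_vecMul_eq_zero (h2 : (2 : ZMod ℓ) ≠ 0) (h3 : s ≠ 0) (hβ : nrm β = ℓ)
    (hl : l ≠ 0) (hlβ : Matrix.vecMul l (toMatrix s hs β) = 0) {v : Quat} (hre : v.re = 0)
    (hv : (ℓ : ℤ) ^ 2 ∣ nrm v) (hv0 : toMatrix s hs v ≠ 0) :
    (∃ w, v = β * w * star β) ↔ Matrix.vecMul l (toMatrix s hs v) = 0 := by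
  have hℓ0 : (ℓ : ℤ) ≠ 0 := by exact_mod_cast (Fact.out : ℓ.Prime).ne_zero
  constructor
  · rintro ⟨w, rfl⟩
    rw [mul_assoc, map_mul, ← Matrix.vecMul_vecMul, hlβ, Matrix.zero_vecMul]
  · intro hlv
    have h0 : toMatrix s hs (star β * v) = 0 := by
      rw [map_mul, toMatrix_star]
      exact adjugate_mul_eq_zero hl hlβ hlv
    obtain ⟨γ, hγ⟩ := exists_eq_smul_of_toMatrix_eq_zero hs h2 h3 h0
    have hvγ : v = β * γ := by
      have h := mul_star_self_mul β v
      rw [hγ, mul_smul_comm, hβ] at h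
      exact (smul_cancel hℓ0 h).symm
    have hstar : star v = -v := QuaternionAlgebra.star_eq_neg.2 hre
    have hvβ : v * β = (ℓ : ℤ) • -star γ := by
      have h := congrArg star hγ
      rw [star_mul, star_star, hstar, star_smul, neg_mul] at h
      rw [smul_neg, ← neg_eq_iff_eq_neg]
      simpa using h
    have hγβ : toMatrix s hs (γ * β) = 0 := by
      rw [map_mul]
      refine mul_eq_zero_of_mul_mul_eq_zero ?_ ?_ ?_ ?_
      · rw [det_toMatrix, hβ]; simp
      · rw [det_toMatrix, ZMod.intCast_zmod_eq_zero_iff_dvd]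
        rw [hvγ, nrm_mul, hβ, sq] at hv
        exact Int.dvd_of_mul_dvd_mul_left hℓ0 hv
      · rwa [← map_mul, ← hvγ]
      · rw [← map_mul, ← hvγ, ← map_mul, hvβ, toMatrix_natCast_smul]
    obtain ⟨w, hw⟩ := exists_eq_smul_of_toMatrix_eq_zero hs h2 h3 hγβ
    rw [eq_conj_iff (hβ ▸ hℓ0), hγ, hβ]
    exact ⟨w, by rw [smul_mul_assoc, hw, smul_smul, sq]⟩

theorem smul_eq_conj_iff (h2 : (2 : ZMod ℓ) ≠ 0) (h3 : s ≠ 0) (hβ : nrm β = ℓ)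
    (hl : l ≠ 0) (hlβ : Matrix.vecMul l (toMatrix s hs β) = 0) (v : Quat) :
    (∃ w, (ℓ : ℤ) • v = β * w * star β) ↔
      dotProduct (Matrix.vecMul l (toMatrix s hs v)) ![l 1, -l 0] = 0 := by
  have hℓ0 : (ℓ : ℤ) ≠ 0 := by exact_mod_cast (Fact.out : ℓ.Prime).ne_zero
  rw [eq_conj_iff (hβ ▸ hℓ0), hβ,
    ← adjugate_mul_mul_eq_zero_iff hl hlβ (toMatrix_ne_zero_of_nrm_eq hs h2 h3 hβ),
    ← toMatrix_star, ← map_mul, ← map_mul, toMatrix_eq_zero_iff hs h2 h3]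
  refine exists_congr fun w => ?_
  rw [mul_smul_comm, smul_mul_assoc, sq, ← smul_smul]
  exact (smul_right_injective Quat hℓ0).eq_iff

end Prime
end Quat

section ProjectiveLine

variable {F : Type*} [Field F]

/-- Normalized coordinates of the points of the projective line. -/
def projPoint : Option F → Fin 2 → F
  | none => ![0, 1]
  | some t => ![1, t]

theorem projPoint_none : projPoint (none : Option F) = ![0, 1] := rfl

theorem projPoint_some (t : F) : projPoint (some t) = ![1, t] := rfl

theorem projPoint_ne_zero (o : Option F) : projPoint o ≠ 0 := by
  cases o with
  | none => exact fun h => one_ne_zero (congrFun h 1)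
  | some t => exact fun h => one_ne_zero (congrFun h 0)

variable [Fintype F] [DecidableEq F]

theorem card_vecMul_projPoint_eq_zero {M : Matrix (Fin 2) (Fin 2) F} (hM : M ≠ 0)
    (hdet : M.det = 0) :
    (Finset.univ.filter fun o : Option F => Matrix.vecMul (projPoint o) M = 0).card = 1 := by
  have hiff (l : Fin 2 → F) : Matrix.vecMul l M = 0 ↔
      l 0 * M 0 0 + l 1 * M 1 0 = 0 ∧ l 0 * M 0 1 + l 1 * M 1 1 = 0 := by
    simp [funext_iff, Matrix.vecMul, dotProduct, Fin.sum_univ_two]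
  rw [Matrix.det_fin_two] at hdet
  simp_rw [hiff]
  rw [Finset.card_eq_one]
  by_cases hc : M 1 0 = 0
  · by_cases hd : M 1 1 = 0
    · refine ⟨none, ?_⟩
      ext (_ | t)
      · simp [projPoint_none, hc, hd]
      · simp only [projPoint_some, Finset.mem_filter, Finset.mem_univ, true_and,
          Finset.mem_singleton, reduceCtorEq, iff_false]
        rintro ⟨h0, h1⟩
        apply hM
        ext i j
        fin_cases i <;> fin_cases j <;> simp_all
    · refine ⟨some (-M 0 1 / M 1 1), ?_⟩
      ext (_ | t)
      · simp [projPoint_none, hd]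
      · simp [projPoint_some, hc]
        have : M 0 0 = 0 := by simpa [hc, hd] using hdet
        simp only [this, true_and]
        rw [eq_div_iff hd]
        constructor <;> intro h <;> linear_combination h
  · refine ⟨some (-M 0 0 / M 1 0), ?_⟩
    ext (_ | t)
    · simp [projPoint_none, hc]
    · simp [projPoint_some]
      rw [eq_div_iff hc]
      refine ⟨fun ⟨h, _⟩ => by linear_combination h, fun h => ⟨by linear_combination h, ?_⟩⟩
      apply mul_left_cancel₀ hc
      linear_combination M 1 1 * h - hdet

theorem card_projPoint_isotropic (h2 : (2 : F) ≠ 0) {A B C r : F} (hr : r ≠ 0)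
    (hABC : A ^ 2 + B * C = r ^ 2) :
    (Finset.univ.filter fun o : Option F =>
      dotProduct (Matrix.vecMul (projPoint o) !![A, B; C, -A])
        ![projPoint o 1, -projPoint o 0] = 0).card = 2 := by
  rw [Finset.card_eq_two]
  by_cases hC : C = 0
  · subst hC
    have hA : A ≠ 0 := by rintro rfl; exact hr (by simpa using hABC.symm)
    refine ⟨none, some (B / (2 * A)), by simp, ?_⟩
    ext (_ | t)
    · simp [projPoint_none, Matrix.vecMul, dotProduct, Fin.sum_univ_two]
    · simp [projPoint_some, Matrix.vecMul, dotProduct, Fin.sum_univ_two]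
      rw [eq_div_iff (mul_ne_zero h2 hA)]
      constructor <;> intro h <;> linear_combination h
  · refine ⟨some ((-A + r) / C), some ((-A - r) / C), ?_, ?_⟩
    · rw [ne_eq, Option.some_inj, div_left_inj' hC]
      exact fun h => mul_ne_zero h2 hr (by linear_combination h)
    · ext (_ | t)
      · simp [projPoint_none, Matrix.vecMul, dotProduct, Fin.sum_univ_two, hC]
      · simp [projPoint_some, Matrix.vecMul, dotProduct, Fin.sum_univ_two]
        rw [eq_div_iff hC, eq_div_iff hC, ← sub_eq_zero (a := t * C), ← sub_eq_zero (a := t * C),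
          ← mul_eq_zero, ← mul_eq_zero_iff_left hC]
        constructor <;> intro h
        · linear_combination h + hABC
        · linear_combination h - hABC

end ProjectiveLine

theorem ZMod.exists_sq_eq_neg_three {p : ℕ} [Fact p.Prime] (h : p % 3 = 1) :
    ∃ s : ZMod p, s ^ 2 = -3 := by
  have : Fact (Nat.Prime 3) := ⟨Nat.prime_three⟩
  obtain ⟨u, hu⟩ := exists_prime_orderOf_dvd_card (G := (ZMod p)ˣ) 3 (by
    rw [ZMod.card_units]
    lia)
  have hu3 : (u : ZMod p) ^ 3 = 1 := by
    rw [← Units.val_pow_eq_pow_val, ← hu, pow_orderOf_eq_one, Units.val_one]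
  have hu1 : (u : ZMod p) - 1 ≠ 0 := by
    rw [sub_ne_zero, ne_eq, Units.val_eq_one]
    rintro rfl
    simp at hu
  have hquad : (u : ZMod p) ^ 2 + u + 1 = 0 := by
    apply mul_left_cancel₀ hu1
    linear_combination hu3
  exact ⟨2 * u + 1, by linear_combination 4 * hquad⟩

theorem ZMod.exists_sq_eq_five {p : ℕ} [Fact p.Prime] (h2 : p ≠ 2)
    (h : p % 5 = 1 ∨ p % 5 = 4) : ∃ s : ZMod p, s ^ 2 = 5 := by
  have : Fact (Nat.Prime 5) := ⟨Nat.prime_five⟩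
  have h5 : IsSquare (p : ZMod 5) := by
    rw [← ZMod.natCast_mod]
    rcases h with h | h <;> rw [h]
    exacts [⟨1, rfl⟩, ⟨2, rfl⟩]
  obtain ⟨s, hs⟩ := (ZMod.exists_sq_eq_prime_iff_of_mod_four_eq_one (p := 5) (by norm_num) h2).1 h5
  exact ⟨s, by simpa [sq] using hs.symm⟩

/-- The integral solutions of `x² + y² + 3z² = n`. -/
noncomputable def ternarySolutions (n : ℤ) : Finset (ℤ × ℤ × ℤ) :=
  (Finset.Icc (-n) n ×ˢ Finset.Icc (-n) n ×ˢ Finset.Icc (-n) n).filter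
    fun t => t.1 ^ 2 + t.2.1 ^ 2 + 3 * t.2.2 ^ 2 = n

theorem mem_ternarySolutions {n : ℤ} {t : ℤ × ℤ × ℤ} :
    t ∈ ternarySolutions n ↔ t.1 ^ 2 + t.2.1 ^ 2 + 3 * t.2.2 ^ 2 = n := by
  simp only [ternarySolutions, Finset.mem_filter, and_iff_right_iff_imp, Finset.mem_product,
    Finset.mem_Icc, ← abs_le]
  intro h
  have key (x : ℤ) : |x| ≤ x ^ 2 := by
    rw [← sq_abs]
    exact Int.le_self_sq _
  have h1 := key t.1
  have h2 := key t.2.1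
  have h3 := key t.2.2
  have h4 := sq_nonneg t.1
  have h5 := sq_nonneg t.2.1
  have h6 := sq_nonneg t.2.2
  refine ⟨?_, ?_, ?_⟩ <;> lia

theorem card_ternarySolutions_five : (ternarySolutions 5).card = 16 := by
  decide +kernel

namespace Quat

/-- The pure quaternion attached to `(x, y, z)`; its norm is `3 * (x² + y² + 3z²)`. -/
def ofTriple (t : ℤ × ℤ × ℤ) : Quat := ⟨0, 3 * t.2.2, t.1, t.2.1⟩

theorem ofTriple_injective : Function.Injective ofTriple := by
  rintro ⟨x, y, z⟩ ⟨x', y', z'⟩ h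
  simp only [ofTriple, QuaternionAlgebra.mk.injEq] at h
  grind

theorem nrm_ofTriple {n : ℤ} {t : ℤ × ℤ × ℤ} :
    nrm (ofTriple t) = 3 * n ↔ t ∈ ternarySolutions n := by
  rw [mem_ternarySolutions]
  simp only [nrm, ofTriple]
  constructor <;> intro h <;> linarith

theorem exists_ofTriple_eq {q : Quat} (hre : q.re = 0) (h : 3 ∣ nrm q) : ∃ t, ofTriple t = q := by
  have h3 : (3 : ℤ) ∣ q.imI ^ 2 := by
    simp only [nrm, hre] at h
    lia
  obtain ⟨z, hz⟩ := Int.prime_three.dvd_of_dvd_pow h3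
  exact ⟨(q.imJ, q.imK, z), by ext <;> simp [ofTriple, hre, hz]⟩

theorem ofTriple_smul (n : ℤ) (t : ℤ × ℤ × ℤ) : ofTriple (n • t) = n • ofTriple t := by
  ext <;> simp [ofTriple, -zsmul_eq_mul]
  ring

theorem re_conj (β w : Quat) : (β * w * star β).re = nrm β * w.re := by
  simp [nrm]
  ring

open Classical in
theorem card_filter_eq_conj {β : Quat} {m n : ℤ} (hβ : nrm β = m) (hm : m ≠ 0) :
    ((ternarySolutions (n * m ^ 2)).filter fun t => ∃ w, ofTriple t = β * w * star β).card =
      (ternarySolutions n).card := by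
  have hnrm (w : Quat) : nrm (β * w * star β) = m ^ 2 * nrm w := by
    rw [nrm_mul, nrm_mul, nrm_star, hβ]
    ring
  have hex (t : ternarySolutions n) : ∃ t', ofTriple t' = β * ofTriple t * star β := by
    apply exists_ofTriple_eq
    · rw [re_conj]
      simp [ofTriple]
    · rw [hnrm, nrm_ofTriple.2 t.2]
      exact ⟨m ^ 2 * n, by ring⟩
  choose f hf using hex
  rw [← Finset.card_attach (s := ternarySolutions n)]
  symm
  refine Finset.card_nbij f ?_ ?_ ?_
  · intro t _
    simp only [Finset.coe_filter, Set.mem_ofPred_eq]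
    refine ⟨?_, _, hf t⟩
    rw [← nrm_ofTriple, hf, hnrm, nrm_ofTriple.2 t.2]
    ring
  · intro t _ t' _ h
    have h' := congrArg (fun t => star β * ofTriple t * β) h
    simp only [hf] at h'
    have key (w : Quat) : star β * (β * w * star β) * β = m ^ 2 • w := by
      rw [mul_assoc β, star_mul_self_mul, smul_mul_assoc, mul_star_mul_self, smul_smul, hβ, sq]
    rw [key, key] at h'
    exact Subtype.ext (ofTriple_injective (smul_cancel (pow_ne_zero 2 hm) h'))
  · intro t ht
    simp only [Finset.coe_filter, Set.mem_ofPred_eq] at ht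
    obtain ⟨ht, w, hw⟩ := ht
    have hwre : w.re = 0 := by
      have h := congrArg QuaternionAlgebra.re hw
      rw [re_conj, hβ] at h
      exact (mul_eq_zero.1 h.symm).resolve_left hm
    have hwn : nrm w = 3 * n := by
      have h := nrm_ofTriple.2 ht
      rw [hw, hnrm] at h
      exact mul_left_cancel₀ (pow_ne_zero 2 hm) (by linarith)
    obtain ⟨t', rfl⟩ := exists_ofTriple_eq hwre ⟨n, hwn⟩
    refine ⟨⟨t', nrm_ofTriple.1 hwn⟩, by simp, ofTriple_injective ?_⟩
    rw [hf, hw]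

open Classical in
theorem card_filter_eq_smul {n m : ℤ} (hm : m ≠ 0) :
    ((ternarySolutions (n * m ^ 2)).filter fun t => ∃ r : Quat, ofTriple t = m • r).card =
      (ternarySolutions n).card := by
  symm
  refine Finset.card_nbij (fun t => m • t) ?_ ?_ ?_
  · intro t ht
    simp only [Finset.coe_filter, Set.mem_ofPred_eq]
    refine ⟨?_, _, ofTriple_smul m t⟩
    rw [← nrm_ofTriple, ofTriple_smul, nrm_smul, nrm_ofTriple.2 ht]
    ring
  · intro t _ t' _ h
    have h' := congrArg ofTriple h
    simp only [ofTriple_smul] at h'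
    exact ofTriple_injective (smul_cancel hm h')
  · intro t ht
    simp only [Finset.coe_filter, Set.mem_ofPred_eq] at ht
    obtain ⟨ht, r, hr⟩ := ht
    have hre : r.re = 0 := by
      have h := congrArg QuaternionAlgebra.re hr
      rw [QuaternionAlgebra.re_smul] at h
      exact (smul_eq_zero.1 h.symm).resolve_left hm
    have hrn : nrm r = 3 * n := by
      have h := nrm_ofTriple.2 ht
      rw [hr, nrm_smul] at h
      exact mul_left_cancel₀ (pow_ne_zero 2 hm) (by linarith)
    obtain ⟨t', rfl⟩ := exists_ofTriple_eq hre ⟨n, hrn⟩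
    exact ⟨t', nrm_ofTriple.1 hrn, ofTriple_injective (by rw [hr, ofTriple_smul])⟩

end Quat

open Quat in
theorem card_ternarySolutions_five_mul_sq {ℓ : ℕ} [Fact ℓ.Prime] (h2 : (2 : ZMod ℓ) ≠ 0)
    {s f : ZMod ℓ} (hs : s ^ 2 = -3) (hs0 : s ≠ 0) (hf : f ^ 2 = 5) (hf0 : f ≠ 0) :
    (ternarySolutions (5 * (ℓ : ℤ) ^ 2)).card = 16 * ℓ := by
  classical
  have hℓ0 : (ℓ : ℤ) ≠ 0 := by exact_mod_cast (Fact.out : ℓ.Prime).ne_zero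
  have hex (o : Option (ZMod ℓ)) := exists_nrm_eq hs h2 hs0 (projPoint_ne_zero o)
  choose β hβ hlβ using hex
  set V := ternarySolutions (5 * (ℓ : ℤ) ^ 2)
  have hcount (t) (ht : t ∈ V) :
      (Finset.univ.filter fun o => ∃ w, ofTriple t = β o * w * star (β o)).card =
        1 + if ∃ r : Quat, ofTriple t = (ℓ : ℤ) • r then 1 else 0 := by
    have htn := nrm_ofTriple.2 ht
    by_cases h : ∃ r : Quat, ofTriple t = (ℓ : ℤ) • r
    · rw [if_pos h]
      obtain ⟨r, hr⟩ := h
      have hrre : r.re = 0 := by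
        have h := congrArg QuaternionAlgebra.re hr
        rw [QuaternionAlgebra.re_smul] at h
        exact (smul_eq_zero.1 h.symm).resolve_left hℓ0
      have hrn : nrm r = 15 := by
        rw [hr, nrm_smul] at htn
        exact mul_left_cancel₀ (pow_ne_zero 2 hℓ0) (by linarith)
      simp_rw [hr, smul_eq_conj_iff hs h2 hs0 (hβ _) (projPoint_ne_zero _) (hlβ _)]
      have hM : toMatrix s hs r = !![s * r.imJ, r.imI - s * r.imK;
          -r.imI - s * r.imK, -(s * r.imJ)] := by
        simp [toMatrix_apply, hrre]
      rw [hM]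
      refine card_projPoint_isotropic h2 (mul_ne_zero hs0 hf0) ?_
      have hdet := det_toMatrix hs r
      rw [hM, Matrix.det_fin_two_of, hrn] at hdet
      push_cast at hdet
      linear_combination -hdet - f ^ 2 * hs + 3 * hf
    · rw [if_neg h]
      have hv0 : toMatrix s hs (ofTriple t) ≠ 0 := by rwa [ne_eq, toMatrix_eq_zero_iff hs h2 hs0]
      have hdvd : (ℓ : ℤ) ^ 2 ∣ nrm (ofTriple t) := ⟨15, by rw [htn]; ring⟩
      simp_rw [eq_conj_iff_vecMul_eq_zero hs h2 hs0 (hβ _) (projPoint_ne_zero _) (hlβ _)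
        (v := ofTriple t) rfl hdvd hv0]
      refine card_vecMul_projPoint_eq_zero hv0 ?_
      rw [det_toMatrix, ZMod.intCast_zmod_eq_zero_iff_dvd]
      exact (dvd_pow_self _ two_ne_zero).trans hdvd
  have hsum := Finset.sum_card_bipartiteAbove_eq_sum_card_bipartiteBelow
    (s := V) (t := (Finset.univ : Finset (Option (ZMod ℓ))))
    fun t o => ∃ w, ofTriple t = β o * w * star (β o)
  simp only [Finset.bipartiteAbove, Finset.bipartiteBelow] at hsum
  rw [Finset.sum_congr rfl hcount, Finset.sum_add_distrib, ← Finset.card_filter,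
    card_filter_eq_smul hℓ0,
    Finset.sum_congr rfl fun o _ => card_filter_eq_conj (hβ o) hℓ0] at hsum
  simp only [Finset.sum_const, Finset.card_univ, Fintype.card_option, ZMod.card,
    card_ternarySolutions_five, smul_eq_mul] at hsum
  lia

/-- For a prime `ℓ ≡ 1, 19 (mod 30)`, the number of integer solutions of
`x² + y² + 3z² = 5ℓ²` equals `16ℓ`. -/
theorem representation_count (ℓ : ℕ) (hℓ : ℓ.Prime) (hmod : ℓ % 30 = 1 ∨ ℓ % 30 = 19) :
    {t : ℤ × ℤ × ℤ | t.1 ^ 2 + t.2.1 ^ 2 + 3 * t.2.2 ^ 2 = 5 * (ℓ : ℤ) ^ 2}.ncard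
      = 16 * ℓ := by
  have : Fact ℓ.Prime := ⟨hℓ⟩
  have hne (p : ℕ) (hp : p.Prime) (h : ℓ ≠ p) : (p : ZMod ℓ) ≠ 0 := by
    rw [ne_eq, ZMod.natCast_eq_zero_iff, Nat.prime_dvd_prime_iff_eq hℓ hp]
    exact h
  obtain ⟨s, hs⟩ := ZMod.exists_sq_eq_neg_three (p := ℓ) (by lia)
  obtain ⟨f, hf⟩ := ZMod.exists_sq_eq_five (p := ℓ) (by lia) (by lia)
  have h2 : (2 : ZMod ℓ) ≠ 0 := mod_cast hne 2 Nat.prime_two (by lia)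
  have hs0 : s ≠ 0 := by
    rintro rfl
    exact hne 3 Nat.prime_three (by lia) (by push_cast; linear_combination hs)
  have hf0 : f ≠ 0 := by
    rintro rfl
    exact hne 5 Nat.prime_five (by lia) (by push_cast; linear_combination -hf)
  rw [← card_ternarySolutions_five_mul_sq h2 hs hs0 hf hf0, ← Set.ncard_coe_finset]
  congr 1
  ext t
  exact mem_ternarySolutions.symm
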